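/- For a nonempty finite set S' of positive reals with |S'| ≥ 2, |S'| / log₂(1 + Σ_{x∈S'} x) < Σ_{x∈S'} 1 / log₂(1+x). -/

import Mathlib

theorem stmt_18 (S' : Finset ℝ) (hpos : ∀ x ∈ S', 0 < x) (hcard : 2 ≤ S'.card) :
    (S'.card : ℝ) / Real.logb 2 (1 + ∑ x ∈ S', x) <
      ∑ x ∈ S', 1 / Real.logb 2 (1 + x) := by
  have hne : S'.Nonempty := Finset.card_pos.mp (by omega)
  have key : ∀ x ∈ S', 1 / Real.logb 2 (1 + ∑ y ∈ S', y) < 1 / Real.logb 2 (1 + x) := by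
    intro x hx
    have hx0 := hpos x hx
    obtain ⟨z, hz, hzx⟩ := Finset.exists_mem_ne (by omega : 1 < S'.card) x
    have hlt : x < ∑ y ∈ S', y :=
      Finset.single_lt_sum (f := fun y => y) hzx hx hz (hpos z hz)
        (fun k hk _ => (hpos k hk).le)
    apply one_div_lt_one_div_of_lt
    · exact Real.logb_pos (by norm_num) (by linarith)
    · exact Real.logb_lt_logb (by norm_num) (by linarith) (by linarith)
  calc (S'.card : ℝ) / Real.logb 2 (1 + ∑ x ∈ S', x)
      = ∑ _x ∈ S', 1 / Real.logb 2 (1 + ∑ y ∈ S', y) := by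
        rw [Finset.sum_const, nsmul_eq_mul, mul_one_div]
    _ < ∑ x ∈ S', 1 / Real.logb 2 (1 + x) := Finset.sum_lt_sum_of_nonempty hne key
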